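/- Let k be a finite field of characteristic p, G a finite group, n ≥ 1, and f : G → GL_n(k) a group homomorphism. Let Ad denote the representation of G on the n×n matrices M_n(k) given by g · M = f(g)·M·f(g)⁻¹. Assume: (1) there is no group homomorphism g : G → GL_n(W₂(k)) whose composition with the natural map GL_n(W₂(k)) → GL_n(k) equals f; and (2) the first group cohomology H¹(G, Ad) vanishes. Then for every commutative Artinian local ring A with a surjective ring homomorphism π : A → k and every group homomorphism ρ : G → GL_n(A) whose composition with the entrywise reduction GL_n(A) → GL_n(k) equals f, one has: p·1_A = 0, and moreover there exist a ring homomorphism s : k → A with π ∘ s = id_k and an element C ∈ GL_n(A) such that ρ(g) = C·(s applied entrywise to f(g))·C⁻¹ for all g ∈ G. -/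

import Mathlib

/-- The natural reduction ring homomorphism `W₂(k) → k` from length-two `p`-typical
Witt vectors to `k`, given by the zeroth coefficient. -/
noncomputable def wittReduce (p : ℕ) [Fact p.Prime] (k : Type*) [CommRing k] :
    TruncatedWittVector p 2 k →+* k :=
  RingHom.liftOfRightInverse (WittVector.truncate 2) TruncatedWittVector.out
    TruncatedWittVector.truncateFun_out
    ⟨WittVector.constantCoeff, fun x hx => by
      rw [WittVector.mem_ker_truncate] at hx
      simpa [RingHom.mem_ker] using hx 0 (by norm_num)⟩

/-- A finite group `G` has property `L_p` if every homomorphism `G → GL_n(k)`, for `k` a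
finite field of characteristic `p`, lifts to `GL_n(W₂(k))`. -/
def HasLp (p : ℕ) [Fact p.Prime] (G : Type*) [Group G] : Prop :=
  ∀ (n : ℕ), 1 ≤ n → ∀ (k : Type) [Field k] [Fintype k] [CharP k p],
    ∀ f : G →* GL (Fin n) k,
      ∃ g : G →* GL (Fin n) (TruncatedWittVector p 2 k),
        (Matrix.GeneralLinearGroup.map (wittReduce p k)).comp g = f

/-- A group has property `L` if it has property `L_p` for every prime `p`. -/
def HasL (G : Type*) [Group G] : Prop :=
  ∀ (p : ℕ) [Fact p.Prime], HasLp p G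

/-- The adjoint representation of `G` on `M_n(k)`, `g · M = f(g)·M·f(g)⁻¹`, attached to a
homomorphism `f : G → GL_n(k)`. -/
def adRep {k : Type} [Field k] {G : Type} [Group G] {n : ℕ}
    (f : G →* GL (Fin n) k) : Representation k G (Matrix (Fin n) (Fin n) k) where
  toFun g := (LinearMap.mulRight k ((↑(f g)⁻¹ : Matrix (Fin n) (Fin n) k))).comp
      (LinearMap.mulLeft k ((↑(f g) : Matrix (Fin n) (Fin n) k)))
  map_one' := by
    ext M
    simp
  map_mul' g h := by
    ext M
    simp [mul_assoc]

section Helpers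

variable {p : ℕ} [Fact p.Prime] {k : Type*} [Field k] [CharP k p]

lemma wittReduce_truncate {R : Type*} [CommRing R] (x : WittVector p R) :
    wittReduce p R (WittVector.truncate 2 x) = x.coeff 0 :=
  RingHom.liftOfRightInverse_comp_apply _ _ _ _ x

/-- If the kernel of `π : A → k` is nilpotent, then a large ghost component vanishes on Witt
vectors with coefficients in this kernel. -/
lemma ghostComponent_eq_zero_of_ker_pow_eq_bot {A : Type*} [CommRing A] (π : A →+* k) {N : ℕ}
    (hN : RingHom.ker π ^ N = ⊥) (x : WittVector p A) (hx : ∀ i, π (x.coeff i) = 0) :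
    WittVector.ghostComponent N x = 0 := by
  rw [WittVector.ghostComponent_apply, aeval_wittPolynomial]
  refine Finset.sum_eq_zero fun i hi => ?_
  have hp : (p : A) ∈ RingHom.ker π := by simp [RingHom.mem_ker]
  have hmem : (p : A) ^ i * x.coeff i ^ p ^ (N - i) ∈ RingHom.ker π ^ N := by
    have hi' : i ≤ N := Nat.lt_succ_iff.mp (Finset.mem_range.mp hi)
    have hle : N - i ≤ p ^ (N - i) := (Nat.lt_pow_self (Fact.out : p.Prime).one_lt).le
    refine Ideal.pow_le_pow_right (show N ≤ i + p ^ (N - i) by omega) ?_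
    rw [pow_add]
    exact Ideal.mul_mem_mul (Ideal.pow_mem_pow hp _) (Ideal.pow_mem_pow (hx i) _)
  rwa [hN, Ideal.mem_bot] at hmem

/-- The Witt vectors of a perfect field map to every nilpotent thickening of that field. -/
lemma exists_wittVector_hom [PerfectRing k p] {A : Type*} [CommRing A] (π : A →+* k)
    (hπ : Function.Surjective π) (hnil : IsNilpotent (RingHom.ker π)) :
    ∃ φ : WittVector p k →+* A, ∀ x, π (φ x) = x.coeff 0 := by
  obtain ⟨N, hN⟩ := hnil
  have hs := WittVector.map_surjective (p := p) π hπ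
  let γ : WittVector p k →+* A := RingHom.liftOfSurjective (WittVector.map π) hs
    ⟨WittVector.ghostComponent N, fun x hx => by
      refine ghostComponent_eq_zero_of_ker_pow_eq_bot π hN x fun i => ?_
      rw [← WittVector.map_coeff, (RingHom.mem_ker).mp hx, WittVector.zero_coeff]⟩
  have hγ : ∀ x, π (γ x) = x.coeff 0 ^ p ^ N := by
    intro x
    obtain ⟨y, rfl⟩ := hs x
    have : γ (WittVector.map π y) = WittVector.ghostComponent N y :=
      RingHom.liftOfRightInverse_comp_apply _ _ _ _ y
    rw [this, WittVector.ghostComponent_apply, aeval_wittPolynomial, map_sum,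
      Finset.sum_eq_single 0]
    · simp
    · intro i _ hi
      simp [hi]
    · simp
  refine ⟨γ.comp (WittVector.map (((frobeniusEquiv k p).symm ^ N : k ≃+* k) : k →+* k)),
    fun x => ?_⟩
  rw [RingHom.comp_apply, hγ, WittVector.map_coeff]
  have h : ∀ (M : ℕ) (y : k), (((frobeniusEquiv k p).symm ^ M : k ≃+* k) y) ^ p ^ M = y := by
    intro M
    induction M with
    | zero => simp
    | succ M ih =>
      intro y
      rw [pow_succ', RingAut.mul_apply, pow_succ', pow_mul, frobeniusEquiv_symm_pow_p, ih]
  exact h N _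

variable {G : Type*} [Group G] {n : ℕ}

/-- A representation over a thickening of `k` in which `p` is a nonzero element killed by the
maximal ideal descends to `W₂(k)` as soon as it is congruent modulo `p` to a matrix of
Teichmüller representatives. -/
lemma exists_lift_of_natCast_ne_zero [PerfectRing k p] {f : G →* GL (Fin n) k}
    {B : Type*} [CommRing B] (π : B →+* k)
    (φ : WittVector p k →+* B) (hφ : ∀ x, π (φ x) = x.coeff 0)
    (hann : ∀ b, π b = 0 → (p : B) * b = 0) (hp : (p : B) ≠ 0) (D : G →* GL (Fin n) B)
    (hD : ∀ g i j, ∃ b, D g i j = φ (WittVector.teichmuller p (f g i j)) + p * b) :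
    ∃ g : G →* GL (Fin n) (TruncatedWittVector p 2 k),
      (Matrix.GeneralLinearGroup.map (wittReduce p k)).comp g = f := by
  have hker : ∀ x, φ x = 0 → WittVector.truncate 2 x = 0 := by
    intro x hx
    have h0 : x.coeff 0 = 0 := by rw [← hφ, hx, map_zero]
    obtain ⟨y, rfl⟩ := Ideal.mem_span_singleton.mp
      ((WittVector.mem_span_p_iff_coeff_zero_eq_zero x).mpr h0)
    have hy : y.coeff 0 = 0 := by
      by_contra hne
      apply hp
      rw [map_mul, map_natCast] at hx
      have h1 : (p : B) * (φ (WittVector.teichmuller p (y.coeff 0)⁻¹) * φ y - 1) = 0 := by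
        apply hann
        rw [map_sub, map_mul, hφ, hφ, WittVector.teichmuller_coeff_zero,
          inv_mul_cancel₀ hne, map_one, sub_self]
      linear_combination φ (WittVector.teichmuller p (y.coeff 0)⁻¹) * hx - h1
    obtain ⟨z, rfl⟩ := Ideal.mem_span_singleton.mp
      ((WittVector.mem_span_p_iff_coeff_zero_eq_zero y).mpr hy)
    rw [← RingHom.mem_ker, WittVector.mem_ker_truncate,
      ← WittVector.mem_span_p_pow_iff_le_coeff_eq_zero, Ideal.mem_span_singleton]
    exact ⟨z, by ring⟩
  have hmem : ∀ g i j, D g i j ∈ φ.range := by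
    intro g i j
    obtain ⟨b, hb⟩ := hD g i j
    refine ⟨WittVector.teichmuller p (f g i j) + p * WittVector.teichmuller p (π b), ?_⟩
    have h1 : (p : B) * (b - φ (WittVector.teichmuller p (π b))) = 0 := by
      apply hann
      rw [map_sub, hφ, WittVector.teichmuller_coeff_zero, sub_self]
    rw [hb, map_add, map_mul, map_natCast]
    linear_combination -h1
  let θ : φ.range →+* TruncatedWittVector p 2 k :=
    RingHom.liftOfSurjective φ.rangeRestrict φ.rangeRestrict_surjective
      ⟨WittVector.truncate 2, fun x hx => hker x (congrArg Subtype.val hx)⟩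
  have hθ : ∀ b : φ.range, wittReduce p k (θ b) = π b := by
    intro b
    obtain ⟨x, rfl⟩ := φ.rangeRestrict_surjective b
    have : θ (φ.rangeRestrict x) = WittVector.truncate 2 x :=
      RingHom.liftOfRightInverse_comp_apply _ _ _ _ x
    rw [this, wittReduce_truncate]
    exact (hφ x).symm
  let D' : G →* Matrix (Fin n) (Fin n) φ.range :=
    { toFun := fun g => Matrix.of fun i j => ⟨D g i j, hmem g i j⟩
      map_one' := by
        ext i j
        by_cases h : i = j <;> simp [h, Matrix.one_apply]
      map_mul' := fun g h => by
        ext i j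
        simp [Matrix.mul_apply] }
  refine ⟨((θ.mapMatrix (m := Fin n)).toMonoidHom.comp D').toHomUnits, ?_⟩
  ext g i j
  change wittReduce p k (θ ⟨D g i j, _⟩) = f g i j
  rw [hθ]
  obtain ⟨b, hb⟩ := hD g i j
  simp [hb, hφ]

end Helpers

lemma exists_eq_of_subsingleton_H1 {k G : Type} [Field k] [Group G] {n : ℕ}
    {f : G →* GL (Fin n) k} (h : Subsingleton (groupCohomology.H1 (Rep.of (adRep f))))
    (c : G → Matrix (Fin n) (Fin n) k)
    (hc : ∀ g h, c (g * h) = (f g : Matrix (Fin n) (Fin n) k) * c h *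
      (↑(f g)⁻¹ : Matrix (Fin n) (Fin n) k) + c g) :
    ∃ M : Matrix (Fin n) (Fin n) k, ∀ g, c g = (f g : Matrix (Fin n) (Fin n) k) * M *
      (↑(f g)⁻¹ : Matrix (Fin n) (Fin n) k) - M := by
  let z : groupCohomology.cocycles₁ (Rep.of (adRep f)) :=
    ⟨c, (groupCohomology.mem_cocycles₁_iff (A := Rep.of (adRep f)) c).mpr hc⟩
  obtain ⟨M, hM⟩ := (groupCohomology.H1π_eq_zero_iff z).mp (Subsingleton.elim _ _)
  exact ⟨M, fun g => (congrFun hM g).symm⟩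

/-- Over a thickening of `k` with a section `s`, a deformation of `f` in the direction of a
socle element `t` is conjugate to the constant one when `H¹(G, Ad) = 0`. -/
lemma exists_conj_of_subsingleton_H1 {k G : Type} [Field k] [Group G] {n : ℕ}
    {f : G →* GL (Fin n) k} (h : Subsingleton (groupCohomology.H1 (Rep.of (adRep f))))
    {B : Type*} [CommRing B] (π : B →+* k) (s : k →+* B) (hs : ∀ x, π (s x) = x)
    (t : B) (ht : t ≠ 0) (hπt : π t = 0) (hann : ∀ b, π b = 0 → t * b = 0)
    (D : G →* GL (Fin n) B)
    (hD : ∀ g i j, ∃ b, D g i j = s (f g i j) + t * b) :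
    ∃ M : Matrix (Fin n) (Fin n) k, ∀ g,
      (1 + t • s.mapMatrix M) * (D g : Matrix (Fin n) (Fin n) B) =
        s.mapMatrix (f g : Matrix (Fin n) (Fin n) k) * (1 + t • s.mapMatrix M) := by
  choose b hb using hD
  let X : G → Matrix (Fin n) (Fin n) k := fun g => Matrix.of fun i j => π (b g i j)
  have hX : ∀ g, (D g : Matrix (Fin n) (Fin n) B) =
      s.mapMatrix (f g : Matrix (Fin n) (Fin n) k) + t • s.mapMatrix (X g) := by
    intro g
    ext i j
    have h1 : t * (b g i j - s (π (b g i j))) = 0 := hann _ (by rw [map_sub, hs, sub_self])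
    simp only [hb, RingHom.mapMatrix_apply, Matrix.add_apply, Matrix.map_apply, Matrix.smul_apply,
      smul_eq_mul, X, Matrix.of_apply]
    linear_combination h1
  have htt : ∀ Y : Matrix (Fin n) (Fin n) B, t • t • Y = 0 := fun Y => by
    rw [smul_smul, hann t hπt, zero_smul]
  have hinj : ∀ Y Z : Matrix (Fin n) (Fin n) k,
      t • s.mapMatrix Y = t • s.mapMatrix Z → Y = Z := by
    intro Y Z hYZ
    ext i j
    by_contra hne
    have h1 : t * s (Y i j) = t * s (Z i j) := congrFun (congrFun hYZ i) j
    apply ht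
    have h2 : s (Y i j - Z i j) * s (Y i j - Z i j)⁻¹ = 1 := by
      rw [← map_mul, mul_inv_cancel₀ (sub_ne_zero.mpr hne), map_one]
    rw [map_sub] at h2
    linear_combination s (Y i j - Z i j)⁻¹ * h1 - t * h2
  have hmul : ∀ g h, X (g * h) = (f g : Matrix (Fin n) (Fin n) k) * X h +
      X g * (f h : Matrix (Fin n) (Fin n) k) := by
    intro g h
    apply hinj
    have h1 := hX (g * h)
    rw [map_mul, Units.val_mul, hX g, hX h, map_mul, Units.val_mul, map_mul] at h1
    simp only [add_mul, mul_add, smul_mul_assoc, mul_smul_comm, smul_add, htt, add_zero,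
      add_assoc] at h1
    rw [map_add, map_mul, map_mul, smul_add, ← add_left_cancel h1]
    abel
  obtain ⟨M, hM⟩ := exists_eq_of_subsingleton_H1 h
    (fun g => X g * (↑(f g)⁻¹ : Matrix (Fin n) (Fin n) k)) (by
      intro g h
      simp only [hmul, map_mul, mul_inv_rev, Units.val_mul, add_mul, mul_assoc,
        Units.mul_inv_cancel_left])
  have hM' : ∀ g, X g = (f g : Matrix (Fin n) (Fin n) k) * M -
      M * (f g : Matrix (Fin n) (Fin n) k) := by
    intro g
    have h1 := congrArg (· * (f g : Matrix (Fin n) (Fin n) k)) (hM g)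
    simpa only [mul_assoc, sub_mul, Units.inv_mul, mul_one] using h1
  refine ⟨M, fun g => ?_⟩
  rw [hX, hM', map_sub, map_mul, map_mul]
  simp only [add_mul, mul_add, mul_sub, smul_mul_assoc, mul_smul_comm, smul_add, smul_sub, htt, one_mul,
    mul_one, add_zero]
  abel

lemma mul_mem_of_covBy {A : Type*} [CommRing A] [IsNoetherianRing A] [IsLocalRing A]
    {I J : Ideal A} (h : I ⋖ J) {a x : A} (ha : a ∈ IsLocalRing.maximalIdeal A) (hx : x ∈ J) :
    a * x ∈ I := by
  have hle : I ⊔ IsLocalRing.maximalIdeal A * J ≤ J := sup_le h.le Ideal.mul_le_right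
  have hlt : I ⊔ IsLocalRing.maximalIdeal A * J ≠ J := fun heq => h.lt.not_ge <|
    Submodule.le_of_le_smul_of_le_jacobson_bot (IsNoetherian.noetherian J)
      (IsLocalRing.maximalIdeal_le_jacobson ⊥) heq.ge
  rw [(h.eq_or_eq le_sup_left hle).resolve_right hlt |>.symm]
  exact Ideal.mem_sup_right (Ideal.mul_mem_mul ha hx)

lemma exists_mul_sub_mem_of_covBy {A : Type*} [CommRing A] {I J : Ideal A} (h : I ⋖ J) {t x : A}
    (ht : t ∈ J) (ht' : t ∉ I) (hx : x ∈ J) : ∃ a, x - t * a ∈ I := by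
  have hJ : I ⊔ Ideal.span {t} = J :=
    (h.eq_or_eq le_sup_left (sup_le h.le ((Ideal.span_singleton_le_iff_mem J).mpr ht))).resolve_left
      fun heq => ht' (heq ▸ Ideal.mem_sup_right (Ideal.mem_span_singleton_self t))
  rw [← hJ] at hx
  obtain ⟨y, hy, z, hz, rfl⟩ := Submodule.mem_sup.mp hx
  obtain ⟨a, rfl⟩ := Ideal.mem_span_singleton.mp hz
  exact ⟨a, by simpa using hy⟩

/-- The inductive step along a covering pair of ideals `I ⋖ J` inside the kernel of `π`: a
deformation constant modulo `J` becomes, after conjugation, constant modulo `I`. -/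
lemma exists_conj_mod_of_covBy {p : ℕ} [Fact p.Prime] {k : Type} [Field k] [CharP k p]
    [PerfectRing k p] {G : Type} [Group G] {n : ℕ} {f : G →* GL (Fin n) k}
    (h1 : ¬ ∃ g : G →* GL (Fin n) (TruncatedWittVector p 2 k),
        (Matrix.GeneralLinearGroup.map (wittReduce p k)).comp g = f)
    (h2 : Subsingleton (groupCohomology.H1 (Rep.of (adRep f))))
    {A : Type*} [CommRing A] [IsNoetherianRing A] [IsLocalRing A]
    (π : A →+* k) (φ : WittVector p k →+* A) (hφ : ∀ x, π (φ x) = x.coeff 0)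
    {I J : Ideal A} (hIJ : I ⋖ J) (hJ : J ≤ RingHom.ker π) (hpJ : (p : A) ∈ J)
    (D : G →* GL (Fin n) A)
    (hD : ∀ g i j, D g i j - φ (WittVector.teichmuller p (f g i j)) ∈ J) :
    (p : A) ∈ I ∧ ∃ E : GL (Fin n) A, ∀ g i j,
      (E * D g * E⁻¹) i j - φ (WittVector.teichmuller p (f g i j)) ∈ I := by
  let q := Ideal.Quotient.mk I
  let πI : A ⧸ I →+* k := Ideal.Quotient.lift I π fun a ha => hJ (hIJ.le ha)
  have hπI : ∀ a, πI (q a) = π a := fun a => Ideal.Quotient.lift_mk I π _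
  have hq : ∀ a, q a = 0 ↔ a ∈ I := fun a => Ideal.Quotient.eq_zero_iff_mem
  have hann : ∀ t ∈ J, ∀ b, πI b = 0 → q t * b = 0 := by
    intro t ht b hb
    obtain ⟨a, rfl⟩ := Ideal.Quotient.mk_surjective b
    have ha : a ∈ IsLocalRing.maximalIdeal A :=
      IsLocalRing.le_maximalIdeal (RingHom.ker_ne_top π) ((hπI a).symm.trans hb)
    rw [mul_comm]
    exact (map_mul q a t).symm.trans ((hq _).mpr (mul_mem_of_covBy hIJ ha ht))
  have hψ : ∀ x, πI (q.comp φ x) = x.coeff 0 := fun x => (hπI _).trans (hφ x)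
  have hDI : ∀ t ∈ J, t ∉ I → ∀ g i j, ∃ b, Matrix.GeneralLinearGroup.map q (D g) i j =
      q.comp φ (WittVector.teichmuller p (f g i j)) + q t * b := by
    intro t ht ht' g i j
    obtain ⟨a, ha⟩ := exists_mul_sub_mem_of_covBy hIJ ht ht' (hD g i j)
    refine ⟨q a, ?_⟩
    rw [← hq, map_sub, map_sub, map_mul] at ha
    rw [Matrix.GeneralLinearGroup.map_apply, RingHom.comp_apply]
    linear_combination ha
  have hpI : (p : A) ∈ I := by
    by_contra hp
    apply h1
    refine exists_lift_of_natCast_ne_zero πI (q.comp φ) hψ ?_ ?_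
      ((Matrix.GeneralLinearGroup.map q).comp D) ?_
    · simpa using hann p hpJ
    · simpa using (hq p).not.mpr hp
    · simpa using hDI p hpJ hp
  refine ⟨hpI, ?_⟩
  obtain ⟨t, htJ, htI⟩ := SetLike.exists_of_lt hIJ.lt
  let s : k →+* A ⧸ I := RingHom.liftOfSurjective (WittVector.constantCoeff (p := p))
    (WittVector.constantCoeff_surjective p) ⟨q.comp φ, by
      rw [WittVector.ker_constantCoeff, Ideal.span_singleton_le_iff_mem, RingHom.mem_ker,
        map_natCast, ← map_natCast q]
      exact (hq _).mpr hpI⟩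
  have hsφ : ∀ x, s (x.coeff 0) = q (φ x) := fun x =>
    RingHom.liftOfRightInverse_comp_apply _ _ _ _ x
  have hsτ : ∀ x, s x = q (φ (WittVector.teichmuller p x)) := fun x => by
    rw [← hsφ, WittVector.teichmuller_coeff_zero]
  obtain ⟨M, hM⟩ := exists_conj_of_subsingleton_H1 h2 πI s
    (fun x => by rw [hsτ, hπI, hφ, WittVector.teichmuller_coeff_zero]) (q t)
    ((hq t).not.mpr htI) ((hπI t).trans (hJ htJ)) (hann t htJ)
    ((Matrix.GeneralLinearGroup.map q).comp D)
    (fun g i j => by simpa [hsτ] using hDI t htJ htI g i j)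
  let E₀ : Matrix (Fin n) (Fin n) A :=
    1 + t • M.map fun x => φ (WittVector.teichmuller p x)
  have hE₀ : IsUnit E₀ := by
    rw [Matrix.isUnit_iff_isUnit_det]
    by_contra hdet
    have hmem : E₀.det ∈ IsLocalRing.maximalIdeal A := hdet
    have h3 : π.mapMatrix E₀ = 1 := by
      have ht : π t = 0 := hJ htJ
      ext i j
      simp [E₀, ht, Matrix.one_apply, apply_ite π]
    have h4 : π E₀.det = 1 := by rw [RingHom.map_det, h3, Matrix.det_one]
    have h5 : E₀.det - 1 ∈ IsLocalRing.maximalIdeal A :=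
      IsLocalRing.le_maximalIdeal (RingHom.ker_ne_top π) (by simp [RingHom.mem_ker, h4])
    exact (IsLocalRing.maximalIdeal.isMaximal A).ne_top
      ((Ideal.eq_top_iff_one _).mpr (by simpa using sub_mem hmem h5))
  have hqE₀ : q.mapMatrix E₀ = 1 + q t • s.mapMatrix M := by
    ext i j
    simp [E₀, hsτ, Matrix.one_apply, apply_ite q]
  refine ⟨hE₀.unit, fun g i j => ?_⟩
  have hconj : q.mapMatrix (hE₀.unit * D g * hE₀.unit⁻¹ : GL (Fin n) A) =
      s.mapMatrix (f g : Matrix (Fin n) (Fin n) k) := by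
    rw [Units.val_mul, Units.val_mul, map_mul, map_mul, IsUnit.unit_spec, hqE₀]
    refine (congrArg (· * _) (hM g)).trans ?_
    rw [← hqE₀, mul_assoc, ← map_mul, IsUnit.mul_val_inv, map_one, mul_one]
  rw [← hq, map_sub, ← hsτ, sub_eq_zero]
  exact congrFun (congrFun hconj i) j

/-- strong rigidity: if `f : G → GL_n(k)` does not lift to `W₂(k)` and
`H¹(G, Ad) = 0`, then any lift of `f` through a surjection `π : A → k`, with `A` a
commutative Artinian local ring, forces `p·1_A = 0` and is conjugate to the constant lift
along a section `s : k → A` of `π`. -/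
theorem strong_rigidity (p : ℕ) [Fact p.Prime] (k : Type) [Field k] [Fintype k] [CharP k p]
    (G : Type) [Group G] [Finite G] (n : ℕ) (hn : 1 ≤ n)
    (f : G →* GL (Fin n) k)
    (h1 : ¬ ∃ g : G →* GL (Fin n) (TruncatedWittVector p 2 k),
        (Matrix.GeneralLinearGroup.map (wittReduce p k)).comp g = f)
    (h2 : Subsingleton (groupCohomology.H1 (Rep.of (adRep f))))
    (A : Type) [CommRing A] [IsArtinianRing A] [IsLocalRing A]
    (π : A →+* k) (hπ : Function.Surjective π)
    (ρ : G →* GL (Fin n) A)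
    (hρ : (Matrix.GeneralLinearGroup.map π).comp ρ = f) :
    (p : A) = 0 ∧ ∃ s : k →+* A, π.comp s = RingHom.id k ∧
      ∃ C : GL (Fin n) A, ∀ g : G,
        ρ g = C * Matrix.GeneralLinearGroup.map s (f g) * C⁻¹ := by
  have hker : RingHom.ker π = IsLocalRing.maximalIdeal A :=
    IsLocalRing.eq_maximalIdeal (RingHom.ker_isMaximal_of_surjective π hπ)
  have hnil : IsNilpotent (RingHom.ker π) := by
    rw [hker, ← IsLocalRing.jacobson_eq_maximalIdeal ⊥ bot_ne_top]
    exact IsArtinianRing.isNilpotent_jacobson_bot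
  obtain ⟨φ, hφ⟩ := exists_wittVector_hom (p := p) π hπ hnil
  have key : ∀ J : Ideal A, J ≤ RingHom.ker π → (p : A) ∈ J →
      (∃ C : GL (Fin n) A, ∀ g i j,
        (C * ρ g * C⁻¹) i j - φ (WittVector.teichmuller p (f g i j)) ∈ J) →
      (p : A) = 0 ∧ ∃ C : GL (Fin n) A, ∀ g i j,
        (C * ρ g * C⁻¹) i j = φ (WittVector.teichmuller p (f g i j)) := by
    intro J
    induction J using WellFoundedLT.induction with
    | ind J ih =>
      rintro hJ hpJ ⟨C, hC⟩
      rcases eq_or_ne J ⊥ with rfl | hne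
      · exact ⟨hpJ, C, fun g i j => sub_eq_zero.mp (hC g i j)⟩
      · obtain ⟨I, -, hIJ⟩ := exists_le_covBy_of_lt (bot_lt_iff_ne_bot.mpr hne)
        obtain ⟨hpI, E, hE⟩ := exists_conj_mod_of_covBy h1 h2 π φ hφ hIJ hJ hpJ
          ((MulAut.conj C).toMonoidHom.comp ρ) hC
        refine ih I hIJ.lt (hIJ.le.trans hJ) hpI ⟨E * C, fun g i j => ?_⟩
        have h3 : E * C * ρ g * (E * C)⁻¹ = E * (C * ρ g * C⁻¹) * E⁻¹ := by group
        rw [h3]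
        exact hE g i j
  obtain ⟨hp, C, hC⟩ := key (RingHom.ker π) le_rfl (by simp [RingHom.mem_ker])
    ⟨1, fun g i j => by
      have h3 : π (ρ g i j) = f g i j := by rw [← hρ]; rfl
      simp [RingHom.mem_ker, hφ, h3]⟩
  let s : k →+* A := RingHom.liftOfSurjective (WittVector.constantCoeff (p := p))
    (WittVector.constantCoeff_surjective p) ⟨φ, by
      rw [WittVector.ker_constantCoeff, Ideal.span_singleton_le_iff_mem, RingHom.mem_ker,
        map_natCast, hp]⟩
  have hs : ∀ x, s x = φ (WittVector.teichmuller p x) := fun x => by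
    conv_lhs => rw [← WittVector.teichmuller_coeff_zero p x]
    exact RingHom.liftOfRightInverse_comp_apply _ _ _ _ (WittVector.teichmuller p x)
  refine ⟨hp, s, ?_, C⁻¹, fun g => ?_⟩
  · ext x
    simp [hs, hφ]
  · have h3 : Matrix.GeneralLinearGroup.map s (f g) = C * ρ g * C⁻¹ := by
      ext i j
      rw [hC, ← hs]
      rfl
    rw [h3]
    group
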